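/- Let G be a finite simple undirected d-regular graph on n ≥ 2 vertices with d ≥ 1, adjacency matrix A, and eigenvalues λ_1 = d ≥ λ_2 ≥ … ≥ λ_n. Then the maximum of I(v; A) over non-constant v ∈ ℝⁿ equals λ_2/d, and λ_2/d = 1 (equivalently λ_2 = d) if and only if G is disconnected. -/

import Mathlib

open Matrix BigOperators Finset

noncomputable def mean {n : ℕ} (v : Fin n → ℝ) : ℝ := (∑ i, v i) / n

noncomputable def centered {n : ℕ} (v : Fin n → ℝ) : Fin n → ℝ := fun i => v i - mean v

noncomputable def moranI {n : ℕ} (W : Matrix (Fin n) (Fin n) ℝ) (v : Fin n → ℝ) : ℝ :=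
  ((n : ℝ) / ∑ i, ∑ j, |W i j|) * (centered v ⬝ᵥ (W *ᵥ centered v)) / (centered v ⬝ᵥ centered v)

/-- `v` is not a constant vector. -/
def Nonconst {n : ℕ} (v : Fin n → ℝ) : Prop := ∃ i j, v i ≠ v j

theorem aux_parseval {n : ℕ} (Φ : Fin n → Fin n → ℝ)
    (horth : ∀ i j, Φ i ⬝ᵥ Φ j = if i = j then (1 : ℝ) else 0) (x y : Fin n → ℝ) :
    x ⬝ᵥ y = ∑ i, (Φ i ⬝ᵥ x) * (Φ i ⬝ᵥ y) := by
  have h1 : (Matrix.of Φ) * (Matrix.of Φ)ᵀ = 1 := by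
    ext i j
    rw [Matrix.mul_apply, Matrix.one_apply, ← horth i j]
    rfl
  have h2 := mul_eq_one_comm.mp h1
  have h3 : (Matrix.of Φ *ᵥ x) ⬝ᵥ (Matrix.of Φ *ᵥ y) = x ⬝ᵥ y := by
    rw [Matrix.dotProduct_mulVec, Matrix.vecMul_mulVec, h2]
    simp
  rw [← h3]
  rfl

theorem aux_symm {n : ℕ} (A : Matrix (Fin n) (Fin n) ℝ) (hs : Aᵀ = A) (x y : Fin n → ℝ) :
    x ⬝ᵥ (A *ᵥ y) = (A *ᵥ x) ⬝ᵥ y := by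
  rw [Matrix.dotProduct_mulVec, ← Matrix.mulVec_transpose, hs]

theorem aux_const {n : ℕ} (x : Fin n → ℝ) (hx : ∑ i, x i = 0) (h : ∀ i j, x i = x j) : x = 0 := by
  funext i
  have h1 : ∑ j, x j = ∑ _j : Fin n, x i := Finset.sum_congr rfl (fun j _ => h j i)
  rw [hx] at h1
  simp only [Finset.sum_const, Finset.card_univ, Fintype.card_fin, nsmul_eq_mul] at h1
  have hn : (n : ℝ) ≠ 0 := by
    have := i.pos
    positivity
  rcases mul_eq_zero.mp h1.symm with h2 | h2
  · exact absurd h2 hn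
  · exact h2

theorem aux_sum_centered {n : ℕ} (hn : 2 ≤ n) (v : Fin n → ℝ) : ∑ i, centered v i = 0 := by
  have hn : (n : ℝ) ≠ 0 := by positivity
  simp only [centered, mean, Finset.sum_sub_distrib, Finset.sum_const, Finset.card_univ,
    Fintype.card_fin, nsmul_eq_mul]
  field_simp
  ring

/-- for a `d`-regular graph, the maximum of Moran's I (adjacency weights)
over non-constant vectors is `λ₂/d`, and `λ₂/d = 1` iff the graph is disconnected. -/
theorem moranI_regular_max {n : ℕ} (hn : 2 ≤ n) (d : ℕ) (hd : 1 ≤ d)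
    (G : SimpleGraph (Fin n)) [DecidableRel G.Adj]
    (A : Matrix (Fin n) (Fin n) ℝ) (hA : A = G.adjMatrix ℝ)
    (hreg : ∀ i, (∑ j, A i j) = (d : ℝ))
    (lam : Fin n → ℝ) (Φ : Fin n → Fin n → ℝ)
    (heig : ∀ i, A *ᵥ Φ i = lam i • Φ i)
    (horth : ∀ i j, Φ i ⬝ᵥ Φ j = if i = j then (1 : ℝ) else 0)
    (hanti : ∀ i j : Fin n, i ≤ j → lam j ≤ lam i)
    (hlam1 : lam ⟨0, by omega⟩ = (d : ℝ)) :
    IsGreatest {y : ℝ | ∃ v : Fin n → ℝ, Nonconst v ∧ moranI A v = y}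
      (lam ⟨1, by omega⟩ / d) ∧
    (lam ⟨1, by omega⟩ / d = 1 ↔ ¬ G.Connected) := by
  have hs : Aᵀ = A := by rw [hA]; exact SimpleGraph.transpose_adjMatrix _
  have hn0 : (0 : ℝ) < n := by positivity
  have hd0 : (0 : ℝ) < d := by positivity
  set i0 : Fin n := ⟨0, by omega⟩ with hi0
  set i1 : Fin n := ⟨1, by omega⟩ with hi1
  have h01 : i0 ≠ i1 := by simp [hi0, hi1]
  have hle : lam i1 ≤ d := by
    rw [← hlam1]; exact hanti _ _ (by simp [hi0, hi1, Fin.le_def])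
  have hle' : ∀ i, i ≠ i0 → lam i ≤ lam i1 := by
    intro i hi
    apply hanti
    have : i.val ≠ 0 := fun h => hi (Fin.ext h)
    simp only [hi1, Fin.le_def]
    omega
  -- the all-ones vector
  let e : Fin n → ℝ := fun _ => 1
  have hAe : A *ᵥ e = (d : ℝ) • e := by
    funext i
    simp [Matrix.mulVec, dotProduct, e, hreg]
  have hed : ∀ x : Fin n → ℝ, x ⬝ᵥ e = ∑ i, x i := by
    intro x; simp [dotProduct, e]
  have hc : ∀ i, lam i * (Φ i ⬝ᵥ e) = d * (Φ i ⬝ᵥ e) := by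
    intro i
    have := aux_symm A hs (Φ i) e
    rw [hAe, heig, dotProduct_smul, smul_dotProduct] at this
    simpa using this.symm
  have hquad : ∀ x : Fin n → ℝ, x ⬝ᵥ (A *ᵥ x) = ∑ i, lam i * (Φ i ⬝ᵥ x) ^ 2 := by
    intro x
    rw [aux_parseval Φ horth]
    refine Finset.sum_congr rfl fun i _ => ?_
    rw [aux_symm A hs (Φ i) x, heig, smul_dotProduct, smul_eq_mul]
    ring
  have hnorm : ∀ x : Fin n → ℝ, x ⬝ᵥ x = ∑ i, (Φ i ⬝ᵥ x) ^ 2 := by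
    intro x
    rw [aux_parseval Φ horth]
    exact Finset.sum_congr rfl fun i _ => (sq _).symm
  have hbound : ∀ x : Fin n → ℝ, ∑ i, x i = 0 → x ⬝ᵥ (A *ᵥ x) ≤ lam i1 * (x ⬝ᵥ x) := by
    intro x hx
    rw [hquad, hnorm, Finset.mul_sum]
    refine Finset.sum_le_sum fun i _ => ?_
    by_cases hi : i = i0
    · subst hi
      rcases eq_or_lt_of_le hle with h | h
      · rw [hlam1, h]
      · have hz : ∀ j, j ≠ i0 → Φ j ⬝ᵥ e = 0 := by
          intro j hj
          by_contra hne
          have := mul_right_cancel₀ hne (hc j)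
          have := hle' j hj
          linarith
        have h1 : e ⬝ᵥ e = (Φ i0 ⬝ᵥ e) * (Φ i0 ⬝ᵥ e) := by
          rw [aux_parseval Φ horth]
          exact Finset.sum_eq_single i0 (fun j _ hj => by rw [hz j hj]; simp) (by simp)
        have h2 : x ⬝ᵥ e = (Φ i0 ⬝ᵥ x) * (Φ i0 ⬝ᵥ e) := by
          rw [aux_parseval Φ horth]
          exact Finset.sum_eq_single i0 (fun j _ hj => by rw [hz j hj]; simp) (by simp)
        have h3 : e ⬝ᵥ e = n := by simp [dotProduct, e]
        have h4 : Φ i0 ⬝ᵥ e ≠ 0 := by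
          intro h4
          rw [h3, h4] at h1
          linarith
        rw [hed, hx] at h2
        have h5 : Φ i0 ⬝ᵥ x = 0 := by
          rcases mul_eq_zero.mp h2.symm with h | h
          · exact h
          · exact absurd h h4
        rw [h5]; simp
    · exact mul_le_mul_of_nonneg_right (hle' i hi) (sq_nonneg _)
  -- an extremal eigenvector
  obtain ⟨v, hv0, hvs, hvA⟩ : ∃ v : Fin n → ℝ, v ≠ 0 ∧ ∑ i, v i = 0 ∧ A *ᵥ v = lam i1 • v := by
    by_cases hc1 : Φ i1 ⬝ᵥ e = 0
    · refine ⟨Φ i1, ?_, ?_, heig i1⟩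
      · intro h
        have := horth i1 i1
        rw [h] at this
        simp at this
      · rw [← hed, hc1]
    · have hl : lam i1 = d := mul_right_cancel₀ hc1 (hc i1)
      refine ⟨(Φ i0 ⬝ᵥ e) • Φ i1 - (Φ i1 ⬝ᵥ e) • Φ i0, ?_, ?_, ?_⟩
      · intro h
        have h2 : Φ i0 ⬝ᵥ ((Φ i0 ⬝ᵥ e) • Φ i1 - (Φ i1 ⬝ᵥ e) • Φ i0) = 0 := by rw [h]; simp
        rw [dotProduct_sub, dotProduct_smul, dotProduct_smul, horth, horth] at h2
        simp [h01] at h2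
        exact hc1 h2
      · rw [← hed, sub_dotProduct, smul_dotProduct, smul_dotProduct, smul_eq_mul, smul_eq_mul]
        ring
      · rw [Matrix.mulVec_sub, Matrix.mulVec_smul, Matrix.mulVec_smul, heig, heig, hlam1, hl,
          smul_sub, smul_comm (d : ℝ), smul_comm (d : ℝ)]
  have hpos : ∀ x : Fin n → ℝ, x ≠ 0 → 0 < x ⬝ᵥ x := by
    intro x hx
    have h1 : 0 ≤ x ⬝ᵥ x := Finset.sum_nonneg fun i _ => mul_self_nonneg _
    exact lt_of_le_of_ne h1 (fun h => hx (dotProduct_self_eq_zero.mp h.symm))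
  have hw : ∑ i, ∑ j, |A i j| = n * d := by
    have : ∀ i, ∑ j, |A i j| = (d : ℝ) := by
      intro i
      rw [← hreg i]
      refine Finset.sum_congr rfl fun j _ => abs_of_nonneg ?_
      rw [hA, SimpleGraph.adjMatrix_apply]
      split_ifs <;> norm_num
    simp [this]
  have hcne : ∀ x : Fin n → ℝ, Nonconst x → centered x ≠ 0 := by
    rintro x ⟨i, j, hij⟩ h
    apply hij
    have h1 := congrFun h i
    have h2 := congrFun h j
    simp only [centered, Pi.zero_apply] at h1 h2
    linarith
  have hmor : ∀ x : Fin n → ℝ, moranI A x =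
      (centered x ⬝ᵥ (A *ᵥ centered x)) / (centered x ⬝ᵥ centered x) / d := by
    intro x
    rw [moranI, hw]
    field_simp
  have hnc : ∀ x : Fin n → ℝ, x ≠ 0 → ∑ i, x i = 0 → Nonconst x := by
    intro x hx hx0
    by_contra h
    apply hx
    apply aux_const x hx0
    intro i j
    by_contra hij
    exact h ⟨i, j, hij⟩
  have hlap : ∀ x : Fin n → ℝ, G.lapMatrix ℝ *ᵥ x = (d : ℝ) • x - A *ᵥ x := by
    intro x
    funext i
    have hdeg : (G.degree i : ℝ) = d := by
      rw [← hreg i, hA]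
      rw [SimpleGraph.degree_eq_sum_if_adj]
      simp only [SimpleGraph.adjMatrix_apply]
    rw [SimpleGraph.lapMatrix_mulVec_apply, hdeg, hA]
    simp [SimpleGraph.adjMatrix_mulVec_apply]
  refine ⟨⟨⟨v, hnc v hv0 hvs, ?_⟩, ?_⟩, ?_⟩
  · have hcv : centered v = v := by
      funext i
      simp [centered, mean, hvs]
    rw [hmor, hcv, hvA, dotProduct_smul, smul_eq_mul, mul_div_assoc,
      div_self (hpos v hv0).ne', mul_one]
  · rintro y ⟨x, hx, rfl⟩
    rw [hmor]
    refine div_le_div_of_nonneg_right ?_ hd0.le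
    rw [div_le_iff₀ (hpos _ (hcne x hx))]
    exact hbound _ (aux_sum_centered hn x)
  · rw [div_eq_one_iff_eq hd0.ne']
    constructor
    · intro h hcon
      have h1 : G.lapMatrix ℝ *ᵥ v = 0 := by rw [hlap, hvA, h, sub_self]
      rw [SimpleGraph.lapMatrix_mulVec_eq_zero_iff_forall_reachable] at h1
      exact hv0 (aux_const v hvs fun i j => h1 i j (hcon.preconnected i j))
    · intro hcon
      refine le_antisymm hle ?_
      have : Nonempty (Fin n) := ⟨i0⟩
      have hpre : ¬ G.Preconnected := fun h => hcon ⟨h⟩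
      simp only [SimpleGraph.Preconnected, not_forall] at hpre
      obtain ⟨a, b, hab⟩ := hpre
      classical
      let x : Fin n → ℝ := fun i => if G.Reachable a i then 1 else 0
      have hxn : Nonconst x := ⟨a, b, by simp [x, hab]⟩
      have hcl : G.lapMatrix ℝ *ᵥ centered x = 0 := by
        rw [SimpleGraph.lapMatrix_mulVec_eq_zero_iff_forall_reachable]
        intro i j hij
        have : G.Reachable a i ↔ G.Reachable a j :=
          ⟨fun h => h.trans hij, fun h => h.trans hij.symm⟩
        simp [centered, x, this]
      rw [hlap, sub_eq_zero] at hcl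
      have hb := hbound _ (aux_sum_centered hn x)
      rw [← hcl, dotProduct_smul, smul_eq_mul] at hb
      exact le_of_mul_le_mul_right hb (hpos _ (hcne x hxn))
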